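/- arXiv:2411.09508 — 3 statements merged into one kernel-verified Lean document; each statement's English description precedes it below -/
import Mathlib

section
/- Let f_1,…,f_m ∈ R = ℂ[x_1,…,x_n] be nonzero, pairwise coprime homogeneous polynomials of positive degree with product f, and let Q ∈ R^{m×(m+n)} be the matrix whose i-th row is (0,…,0,f_i,0,…,0, ∂f_i/∂x_1,…,∂f_i/∂x_n) with f_i in the i-th position. Then the map sending a derivation θ = Σ_j b_j ∂/∂x_j ∈ Der(A) to the vector (a,b) ∈ R^m × R^n, where a_i ∈ R is the unique element with θ(f_i) = −a_i f_i, is a well-defined R-module isomorphism from Der(A) onto the kernel of the R-linear map R^{m+n} → R^m given by Q. -/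
open MvPolynomial

noncomputable section

/-- The polynomial ring `R = ℂ[x_1,…,x_n]`. -/
abbrev PolyR (n : ℕ) : Type := MvPolynomial (Fin n) ℂ

/-- The polynomial ring `ℂ[x_1,…,x_n,s_i : i ∈ ι]`. -/
abbrev PolyRS (n : ℕ) (ι : Type) : Type := MvPolynomial (Fin n ⊕ ι) ℂ

variable {n : ℕ} {ι : Type} [Fintype ι]

/-- The `R`-linear map given by the matrix `Q`, sending `(a, b)` to the vector with
`i`-th entry `a_i f_i + Σ_j b_j ∂f_i/∂x_j`. -/
def Qmap (f : ι → PolyR n) :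
    ((ι → PolyR n) × (Fin n → PolyR n)) →ₗ[PolyR n] (ι → PolyR n) where
  toFun ab := fun i => ab.1 i * f i + ∑ j, ab.2 j * pderiv j (f i)
  map_add' x y := by
    funext i
    simp only [Prod.fst_add, Prod.snd_add, Pi.add_apply, add_mul, Finset.sum_add_distrib]
    ring
  map_smul' r x := by
    funext i
    simp only [Prod.smul_fst, Prod.smul_snd, Pi.smul_apply, smul_eq_mul, RingHom.id_apply,
      mul_assoc, ← Finset.mul_sum]
    ring

/-- The `R`-linear map given by the Jacobian matrix `Jac(F)`. -/
def jacMap (f : ι → PolyR n) : (Fin n → PolyR n) →ₗ[PolyR n] (ι → PolyR n) where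
  toFun b := fun i => ∑ j, b j * pderiv j (f i)
  map_add' x y := by
    funext i
    simp only [Pi.add_apply, add_mul, Finset.sum_add_distrib]
  map_smul' r x := by
    funext i
    simp only [Pi.smul_apply, smul_eq_mul, RingHom.id_apply, mul_assoc, ← Finset.mul_sum]

/-- The log-derivation module `logDer(A) ⊆ R^m`. -/
def logDer (f : ι → PolyR n) : Submodule (PolyR n) (ι → PolyR n) where
  carrier := {a | ∃ b : Fin n → PolyR n, ∀ i, a i * f i + ∑ j, b j * pderiv j (f i) = 0}
  zero_mem' := ⟨0, fun i => by simp⟩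
  add_mem' := by
    rintro a a' ⟨b, hb⟩ ⟨b', hb'⟩
    refine ⟨b + b', fun i => ?_⟩
    have h1 := hb i
    have h2 := hb' i
    simp only [Pi.add_apply, add_mul, Finset.sum_add_distrib]
    linear_combination h1 + h2
  smul_mem' := by
    rintro c a ⟨b, hb⟩
    refine ⟨c • b, fun i => ?_⟩
    have h1 := hb i
    simp only [Pi.smul_apply, smul_eq_mul, mul_assoc, ← Finset.mul_sum]
    linear_combination c * h1

/-- The pre-likelihood ideal `I₀(A) ⊆ ℂ[x,s]`, generated by the polynomials
`Σ_i a_i s_i` for `a ∈ logDer(A)`. -/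
def preLikelihoodIdeal (f : ι → PolyR n) : Ideal (PolyRS n ι) :=
  Ideal.span {g | ∃ a ∈ logDer f, g = ∑ i, rename Sum.inl (a i) * X (Sum.inr i)}

/-- The Jacobian matrix of `F = (f_1,…,f_m)` evaluated at a point `x ∈ ℂ^n`. -/
def jacAt (f : ι → PolyR n) (x : Fin n → ℂ) : Matrix ι (Fin n) ℂ :=
  Matrix.of fun i j => eval x (pderiv j (f i))

/-- The maximal rank of the Jacobian matrix over all points of `ℂ^n`. -/
def jacMaxRank (f : ι → PolyR n) : ℕ :=
  ⨆ x : Fin n → ℂ, (jacAt f x).rank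

/-- The critical-point locus of the log-likelihood `ℓ_A = Σ_j s_j log f_j`,
with denominators cleared, together with the maximal-rank regularity condition. -/
def critLocus [DecidableEq ι] (f : ι → PolyR n) : Set ((Fin n → ℂ) × (ι → ℂ)) :=
  {p | (∀ j, eval p.1 (f j) ≠ 0) ∧ (jacAt f p.1).rank = jacMaxRank f ∧
    ∀ i : Fin n, ∑ j, p.2 j * eval p.1 (pderiv i (f j)) *
      ∏ k ∈ Finset.univ.erase j, eval p.1 (f k) = 0}

/-- The likelihood ideal `I(A)`: all polynomials in `ℂ[x,s]` vanishing on the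
critical-point locus. -/
def likelihoodIdeal [DecidableEq ι] (f : ι → PolyR n) : Ideal (PolyRS n ι) where
  carrier := {g | ∀ p ∈ critLocus f, eval (Sum.elim p.1 p.2) g = 0}
  zero_mem' := fun p _ => by simp
  add_mem' := fun {a b} ha hb p hp => by simp [map_add, ha p hp, hb p hp]
  smul_mem' := fun c g hg p hp => by simp [smul_eq_mul, hg p hp]

/-- An arrangement is gentle if its pre-likelihood ideal equals its likelihood ideal. -/
def IsGentle [DecidableEq ι] (f : ι → PolyR n) : Prop :=
  preLikelihoodIdeal f = likelihoodIdeal f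

/-- The module `Der(A)` of `A`-derivations: derivations `θ` with `θ(f) ∈ ⟨f⟩`,
where `f = f_1 ⋯ f_m`. -/
def DerA (f : ι → PolyR n) : Submodule (PolyR n) (Derivation ℂ (PolyR n) (PolyR n)) where
  carrier := {θ | θ (∏ i, f i) ∈ Ideal.span {∏ i, f i}}
  zero_mem' := by simp
  add_mem' := by
    intro a b ha hb
    simpa using Ideal.add_mem _ ha hb
  smul_mem' := by
    intro c θ hθ
    simpa [smul_eq_mul] using Ideal.mul_mem_left _ c hθ

end

/-- A derivation of a polynomial ring is the combination of the partial derivatives with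
coefficients its values at the variables. -/
theorem derivation_apply_eq_sum_pderiv {n : ℕ} (θ : Derivation ℂ (PolyR n) (PolyR n))
    (p : PolyR n) : θ p = ∑ j, θ (X j) * pderiv j p := by
  have hsum (q : PolyR n) :
      (∑ j, θ (X j) • pderiv j : Derivation ℂ (PolyR n) (PolyR n)) q
        = ∑ j, θ (X j) * pderiv j q := by
    have h := map_sum (Derivation.coeFnAddMonoidHom (R := ℂ) (A := PolyR n) (M := PolyR n))
      (fun j => θ (X j) • pderiv j) Finset.univ
    exact (congrFun h q).trans (Finset.sum_apply _ _ _)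
  rw [← hsum]
  refine DFunLike.congr_fun (derivation_ext fun i => ?_) p
  rw [hsum]
  simp [pderiv_X, Pi.single_apply]

/-- If a derivation preserves the ideals `⟨f i⟩`, it preserves the ideal of their product. -/
theorem Derivation.prod_dvd_apply_prod {R A ι : Type*} [CommSemiring R] [CommSemiring A]
    [Algebra R A] (θ : Derivation R A A) (f : ι → A) (s : Finset ι)
    (h : ∀ i ∈ s, f i ∣ θ (f i)) : ∏ i ∈ s, f i ∣ θ (∏ i ∈ s, f i) := by
  classical
  induction s using Finset.induction_on with
  | empty => simp
  | insert a s ha ih =>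
    rw [Finset.prod_insert ha, θ.leibniz, smul_eq_mul, smul_eq_mul]
    refine dvd_add
      (mul_dvd_mul_left _ (ih fun i hi => h i (Finset.mem_insert_of_mem hi))) ?_
    rw [mul_comm (f a)]
    exact mul_dvd_mul_left _ (h a (Finset.mem_insert_self a s))

/-- If a derivation preserves the ideal of a product of pairwise coprime factors, it preserves
the ideal of each factor. -/
theorem Derivation.dvd_apply_of_prod_dvd_apply_prod {R A ι : Type*} [CommRing R] [CommRing A]
    [DecompositionMonoid A] [Algebra R A] (θ : Derivation R A A) (f : ι → A) (s : Finset ι)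
    (hcop : ∀ i j, i ≠ j → IsRelPrime (f i) (f j))
    (h : ∏ i ∈ s, f i ∣ θ (∏ i ∈ s, f i)) {i : ι} (hi : i ∈ s) : f i ∣ θ (f i) := by
  classical
  have hdvd := (Finset.dvd_prod_of_mem f hi).trans h
  rw [← Finset.mul_prod_erase s f hi, θ.leibniz, smul_eq_mul, smul_eq_mul] at hdvd
  refine IsRelPrime.dvd_of_dvd_mul_left (IsRelPrime.prod_right fun j hj => ?_)
    ((dvd_add_right (dvd_mul_right _ _)).1 hdvd)
  exact hcop i j (Finset.ne_of_mem_erase hj).symm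

theorem mem_DerA_iff {n m : ℕ} {f : Fin m → PolyR n}
    (hcop : ∀ i j, i ≠ j → IsRelPrime (f i) (f j)) (θ : Derivation ℂ (PolyR n) (PolyR n)) :
    θ ∈ DerA f ↔ ∀ i, f i ∣ θ (f i) := by
  change θ (∏ i, f i) ∈ Ideal.span {∏ i, f i} ↔ _
  rw [Ideal.mem_span_singleton]
  exact ⟨fun h i => θ.dvd_apply_of_prod_dvd_apply_prod f _ hcop h (Finset.mem_univ i),
    fun h => θ.prod_dvd_apply_prod f _ fun i _ => h i⟩

theorem mem_ker_Qmap_iff {n m : ℕ} {f : Fin m → PolyR n}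
    {p : (Fin m → PolyR n) × (Fin n → PolyR n)} :
    p ∈ LinearMap.ker (Qmap f) ↔ ∀ i, mkDerivation ℂ p.2 (f i) = -(p.1 i) * f i := by
  rw [LinearMap.mem_ker, funext_iff]
  refine forall_congr' fun i => ?_
  change p.1 i * f i + ∑ j, p.2 j * pderiv j (f i) = 0 ↔ _
  rw [derivation_apply_eq_sum_pderiv]
  simp only [mkDerivation_X]
  rw [neg_mul, eq_neg_iff_add_eq_zero, add_comm]

open MvPolynomial in
/-- For an arrangement of nonzero, pairwise coprime homogeneous polynomials
of positive degree, the map sending `θ ∈ Der(A)` to `(a, b)` — where `b_j = θ(x_j)` and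
`a_i` is the unique element with `θ(f_i) = −a_i f_i` — is a well-defined `R`-module
isomorphism from `Der(A)` onto the kernel of the map `R^{m+n} → R^m` given by `Q`. -/
theorem statement1 {n m : ℕ} (f : Fin m → PolyR n) (d : Fin m → ℕ)
    (hne : ∀ i, f i ≠ 0)
    (hhom : ∀ i, (f i).IsHomogeneous (d i))
    (hd : ∀ i, 0 < d i)
    (hcop : ∀ i j, i ≠ j → IsRelPrime (f i) (f j)) :
    ∃ e : ↥(DerA f) ≃ₗ[PolyR n] ↥(LinearMap.ker (Qmap f)),
      ∀ θ : DerA f,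
        ((e θ).1.2 = fun j => θ.1 (X j)) ∧
        ∀ i, θ.1 (f i) = -((e θ).1.1 i) * f i := by
  let g : ↥(LinearMap.ker (Qmap f)) →ₗ[PolyR n] ↥(DerA f) :=
    { toFun := fun p => ⟨mkDerivation ℂ p.1.2, (mem_DerA_iff hcop _).2 fun i => by
        rw [mem_ker_Qmap_iff.1 p.2 i]
        exact dvd_mul_left _ _⟩
      map_add' := fun p q => Subtype.ext <| derivation_ext fun j => by simp [mkDerivation_X]
      map_smul' := fun c p => Subtype.ext <| derivation_ext fun j => by simp [mkDerivation_X] }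
  have hg (p) : (g p).1 = mkDerivation ℂ p.1.2 := rfl
  have hinj : Function.Injective g := by
    intro p q hpq
    have hder : mkDerivation ℂ p.1.2 = mkDerivation ℂ q.1.2 := congrArg Subtype.val hpq
    refine Subtype.ext (Prod.ext (funext fun i => ?_) (funext fun j => ?_))
    · have h := mem_ker_Qmap_iff.1 p.2 i
      rw [hder, mem_ker_Qmap_iff.1 q.2 i] at h
      exact (neg_injective (mul_right_cancel₀ (hne i) h)).symm
    · simpa [mkDerivation_X] using congrArg (fun D => D (X j)) hder
  have hsurj : Function.Surjective g := by
    intro θ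
    choose a ha using (mem_DerA_iff hcop θ.1).1 θ.2
    have hθ : mkDerivation ℂ (fun j => θ.1 (X j)) = θ.1 :=
      derivation_ext fun j => mkDerivation_X _ _ _
    refine ⟨⟨(fun i => -a i, fun j => θ.1 (X j)), mem_ker_Qmap_iff.2 fun i => ?_⟩,
      Subtype.ext hθ⟩
    rw [hθ, ha i, neg_neg, mul_comm]
  let e := LinearEquiv.ofBijective g ⟨hinj, hsurj⟩
  refine ⟨e.symm, fun θ => ?_⟩
  have hθ : mkDerivation ℂ (e.symm θ).1.2 = θ.1 :=
    congrArg Subtype.val (e.apply_symm_apply θ)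
  refine ⟨funext fun j => ?_, fun i => ?_⟩
  · rw [← hθ, mkDerivation_X]
  · rw [← hθ]
    exact mem_ker_Qmap_iff.1 (e.symm θ).2 i
end

section
/- Let f_1,…,f_m ∈ ℂ[x_1,…,x_n] be nonzero homogeneous polynomials of positive degree with m > n. Then the likelihood ideal I(A), i.e., the ideal of all polynomials in ℂ[x_1,…,x_n,s_1,…,s_m] vanishing on the critical-point locus S of the log-likelihood, is a prime ideal. -/
open MvPolynomial

noncomputable section

variable {n : ℕ} {ι : Type} [Fintype ι]

/-- A matrix of rank `r` over a field has an identity `r × r` block after multiplying on both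
sides by suitable matrices. -/
theorem Matrix.exists_mul_mul_eq_one_of_rank {K k l : Type*} [Field K] [Fintype k] [Fintype l]
    [DecidableEq k] [DecidableEq l] (M : Matrix k l K) :
    ∃ (P : Matrix (Fin M.rank) k K) (Q : Matrix l (Fin M.rank) K), P * M * Q = 1 := by
  obtain ⟨g, hg⟩ := M.mulVecLin.rangeRestrict.exists_rightInverse_of_surjective
    M.mulVecLin.range_rangeRestrict
  obtain ⟨p, hp⟩ := (LinearMap.range M.mulVecLin).subtype.exists_leftInverse_of_injective
    (Submodule.ker_subtype _)
  let e : LinearMap.range M.mulVecLin ≃ₗ[K] (Fin M.rank → K) :=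
    (Module.finBasis K (LinearMap.range M.mulVecLin)).equivFun
  refine ⟨LinearMap.toMatrix' (e.toLinearMap ∘ₗ p), LinearMap.toMatrix' (g ∘ₗ e.symm.toLinearMap),
    ?_⟩
  have hM : M = LinearMap.toMatrix' M.mulVecLin := (LinearMap.toMatrix'_toLin' M).symm
  conv_lhs => enter [1, 2]; rw [hM]
  rw [← LinearMap.toMatrix'_comp, ← LinearMap.toMatrix'_comp, ← LinearMap.toMatrix'_id]
  congr 1
  refine LinearMap.ext fun v => ?_
  have h2 : M.mulVecLin (g (e.symm v)) = (LinearMap.range M.mulVecLin).subtype (e.symm v) :=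
    congrArg Subtype.val (LinearMap.congr_fun hg (e.symm v))
  have h3 := LinearMap.congr_fun hp (e.symm v)
  simp only [LinearMap.comp_apply, LinearEquiv.coe_coe, LinearMap.id_apply] at h3 ⊢
  rw [h2, h3, e.apply_symm_apply]

/-- If `B` is obtained from `A` by multiplying on the left, and `rank A ≤ rank B`, then `A` and `B`
have the same kernel. -/
theorem Matrix.mulVec_eq_zero_of_rank_le {K k l p : Type*} [Field K] [Fintype k] [Fintype l]
    (P : Matrix p k K) (A : Matrix k l K) (h : A.rank ≤ (P * A).rank)
    {v : l → K} (hv : (P * A).mulVec v = 0) : A.mulVec v = 0 := by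
  classical
  have hle : LinearMap.ker A.mulVecLin ≤ LinearMap.ker (P * A).mulVecLin := by
    intro w hw
    simp only [LinearMap.mem_ker, Matrix.mulVecLin_apply] at hw ⊢
    rw [← Matrix.mulVec_mulVec, hw, Matrix.mulVec_zero]
  have hA := A.mulVecLin.finrank_range_add_finrank_ker
  have hB := (P * A).mulVecLin.finrank_range_add_finrank_ker
  have heq := Submodule.eq_of_le_of_finrank_le hle (by unfold Matrix.rank at h; omega)
  have : v ∈ LinearMap.ker (P * A).mulVecLin := by simpa using hv
  rw [← heq] at this
  simpa using this

theorem RingHom.comp_mulVec {R S k l : Type*} [NonAssocSemiring R] [NonAssocSemiring S]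
    [Fintype l] (φ : R →+* S) (M : Matrix k l R) (w : l → R) :
    φ ∘ M.mulVec w = (M.map φ).mulVec (φ ∘ w) :=
  funext fun i => RingHom.map_mulVec φ M w i

/-- A kernel vector of a specialization `A(x₀)` of a polynomial matrix extends to a polynomial
vector that lies in the kernel of `A(x)` at all `x` in a neighbourhood of `x₀` with
`rank A(x) ≤ rank A(x₀)`; in this neighbourhood the rank does not drop. -/
theorem exists_polynomial_kernel_section {K σ k l : Type*} [Field K] [Fintype k] [Fintype l]
    (A : Matrix k l (MvPolynomial σ K)) (x₀ : σ → K) (s₀ : l → K)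
    (hs₀ : (A.map (eval x₀)).mulVec s₀ = 0) :
    ∃ (δ : MvPolynomial σ K) (v : l → MvPolynomial σ K), eval x₀ δ ≠ 0 ∧
      (∀ j, eval x₀ (v j) = s₀ j) ∧
      ∀ x, eval x δ ≠ 0 → (A.map (eval x₀)).rank ≤ (A.map (eval x)).rank ∧
        ((A.map (eval x)).rank ≤ (A.map (eval x₀)).rank →
          (A.map (eval x)).mulVec (fun j => eval x (v j)) = 0) := by
  classical
  obtain ⟨P, Q, hPQ⟩ := (A.map (eval x₀)).exists_mul_mul_eq_one_of_rank
  generalize hr : (A.map (eval x₀)).rank = r at P Q hPQ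
  let P' : Matrix (Fin r) k (MvPolynomial σ K) := P.map C
  let Q' : Matrix l (Fin r) (MvPolynomial σ K) := Q.map C
  let B : Matrix (Fin r) (Fin r) (MvPolynomial σ K) := P' * A * Q'
  let v : l → MvPolynomial σ K := B.det • (fun j => C (s₀ j)) -
    Q'.mulVec (B.adjugate.mulVec ((P' * A).mulVec fun j => C (s₀ j)))
  have hC : ∀ x : σ → K, (eval x) ∘ (C : K → MvPolynomial σ K) = id := fun x => by
    ext a; simp
  have hB : ∀ x, B.map (eval x) = P * A.map (eval x) * Q := fun x => by
    simp only [B, P', Q', Matrix.map_mul, Matrix.map_map, hC, Matrix.map_id]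
  have hdet : ∀ x, eval x B.det = (P * A.map (eval x) * Q).det := fun x => by
    rw [RingHom.map_det, RingHom.mapMatrix_apply, hB]
  have hadj : ∀ x, B.adjugate.map (eval x) = (P * A.map (eval x) * Q).adjugate := fun x => by
    rw [← hB, ← RingHom.mapMatrix_apply, RingHom.map_adjugate, RingHom.mapMatrix_apply]
  have hv : ∀ x, (fun j => eval x (v j)) = (P * A.map (eval x) * Q).det • s₀ -
      Q.mulVec ((P * A.map (eval x) * Q).adjugate.mulVec ((P * A.map (eval x)).mulVec s₀)) := by
    intro x
    funext j
    simp only [v, Pi.sub_apply, Pi.smul_apply, smul_eq_mul, map_sub, map_mul, hdet, eval_C,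
      RingHom.map_mulVec]
    have hs : (eval x) ∘ (fun j => (C (s₀ j) : MvPolynomial σ K)) = s₀ := by
      funext i; simp
    simp only [RingHom.comp_mulVec, hs, hadj, P', Q', Matrix.map_mul, Matrix.map_map, hC, Matrix.map_id]
  refine ⟨B.det, v, ?_, ?_, ?_⟩
  · rw [hdet, hPQ, Matrix.det_one]
    exact one_ne_zero
  · intro j
    have := congrFun (hv x₀) j
    rw [this, ← Matrix.mulVec_mulVec, hs₀, hPQ]
    simp
  · intro x hx
    rw [hdet] at hx
    have hrank : r ≤ (P * A.map (eval x)).rank := by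
      calc r = (P * A.map (eval x) * Q).rank := by
            rw [Matrix.rank_of_isUnit _ ((Matrix.isUnit_iff_isUnit_det _).2 hx.isUnit),
              Fintype.card_fin]
        _ ≤ _ := Matrix.rank_mul_le_left _ _
    refine ⟨hrank.trans (Matrix.rank_mul_le_right _ _), fun hle => ?_⟩
    refine Matrix.mulVec_eq_zero_of_rank_le P _ (hle.trans hrank) ?_
    rw [hv, Matrix.mulVec_sub, Matrix.mulVec_smul, Matrix.mulVec_mulVec, Matrix.mulVec_mulVec,
      Matrix.mul_adjugate, Matrix.smul_mulVec, Matrix.one_mulVec, sub_self]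

/-- The matrix of the critical point equations `Σ_j s_j ∂_i f_j ∏_{k ≠ j} f_k = 0`. -/
def critMatrix [DecidableEq ι] (f : ι → PolyR n) : Matrix (Fin n) ι (PolyR n) :=
  Matrix.of fun i j => pderiv i (f j) * ∏ k ∈ Finset.univ.erase j, f k

theorem critMatrix_mulVec_eq_zero_iff [DecidableEq ι] (f : ι → PolyR n) (x : Fin n → ℂ)
    (s : ι → ℂ) : ((critMatrix f).map (eval x)).mulVec s = 0 ↔
      ∀ i : Fin n, ∑ j, s j * eval x (pderiv i (f j)) *
        ∏ k ∈ Finset.univ.erase j, eval x (f k) = 0 := by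
  rw [funext_iff]
  refine forall_congr' fun i => ?_
  simp only [Matrix.mulVec, dotProduct, critMatrix, Matrix.map_apply, Matrix.of_apply, map_mul,
    map_prod, Pi.zero_apply]
  refine Eq.congr (Finset.sum_congr rfl fun j _ => ?_) rfl
  ring

theorem rank_critMatrix [DecidableEq ι] (f : ι → PolyR n) (x : Fin n → ℂ)
    (hx : ∀ j, eval x (f j) ≠ 0) :
    ((critMatrix f).map (eval x)).rank = (jacAt f x).rank := by
  have h : (critMatrix f).map (eval x) = (jacAt f x).transpose *
      Matrix.diagonal fun j => ∏ k ∈ Finset.univ.erase j, eval x (f k) := by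
    ext i j
    simp [critMatrix, jacAt, Matrix.mul_diagonal]
  rw [h, Matrix.rank_mul_eq_left_of_isUnit_det, Matrix.rank_transpose]
  rw [Matrix.det_diagonal, isUnit_iff_ne_zero]
  exact Finset.prod_ne_zero_iff.2 fun j _ => Finset.prod_ne_zero_iff.2 fun k _ => hx k

theorem bddAbove_range_rank_jacAt {κ : Type} (f : κ → PolyR n) :
    BddAbove (Set.range fun x => (jacAt f x).rank) :=
  ⟨n, by rintro _ ⟨x, rfl⟩; simpa using (jacAt f x).rank_le_card_width⟩

theorem rank_jacAt_le_jacMaxRank {κ : Type} (f : κ → PolyR n) (x : Fin n → ℂ) :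
    (jacAt f x).rank ≤ jacMaxRank f :=
  le_ciSup (bddAbove_range_rank_jacAt f) x

theorem exists_rank_jacAt_eq_jacMaxRank {κ : Type} (f : κ → PolyR n) :
    ∃ x, (jacAt f x).rank = jacMaxRank f :=
  Nat.sSup_mem (Set.range_nonempty _) (bddAbove_range_rank_jacAt f)

theorem MvPolynomial.exists_eval_ne_zero {K σ : Type*} [Field K] [Infinite K]
    {p : MvPolynomial σ K} (hp : p ≠ 0) : ∃ x, eval x p ≠ 0 := by
  by_contra! h
  exact hp (MvPolynomial.funext fun x => by simpa using h x)

theorem critLocus_nonempty [DecidableEq ι] (f : ι → PolyR n) (hne : ∀ i, f i ≠ 0) :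
    (critLocus f).Nonempty := by
  obtain ⟨x₀, hx₀⟩ := exists_rank_jacAt_eq_jacMaxRank f
  let J : Matrix ι (Fin n) (PolyR n) := Matrix.of fun i j => pderiv j (f i)
  have hJ : ∀ x, J.map (eval x) = jacAt f x := fun x => rfl
  obtain ⟨δ, v, hδ, hv, h⟩ := exists_polynomial_kernel_section J x₀ 0 (Matrix.mulVec_zero _)
  have hδ0 : δ ≠ 0 := by rintro rfl; simp at hδ
  obtain ⟨x, hx⟩ := MvPolynomial.exists_eval_ne_zero
    (mul_ne_zero hδ0 (Finset.prod_ne_zero_iff.2 fun i (_ : i ∈ Finset.univ) => hne i))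
  rw [map_mul, map_prod, mul_ne_zero_iff, Finset.prod_ne_zero_iff] at hx
  have hr := (h x hx.1).1
  rw [hJ, hJ, hx₀] at hr
  exact ⟨(x, 0), fun j => hx.2 j (Finset.mem_univ j),
    (rank_jacAt_le_jacMaxRank f x).antisymm hr, fun i => by simp⟩

/-- The condition that `g` does not vanish on the fibre of the critical locus over `x` holds on a
nonempty Zariski open set as soon as it holds at one point. -/
theorem exists_open_of_eval_ne_zero [DecidableEq ι] (f : ι → PolyR n) (g : PolyRS n ι)
    (p : (Fin n → ℂ) × (ι → ℂ)) (hp : p ∈ critLocus f) (hg : eval (Sum.elim p.1 p.2) g ≠ 0) :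
    ∃ D : PolyR n, D ≠ 0 ∧ ∀ x, eval x D ≠ 0 →
      ∃ s, (x, s) ∈ critLocus f ∧ eval (Sum.elim x s) g ≠ 0 := by
  obtain ⟨hf, hr, hs⟩ := hp
  obtain ⟨δ, v, hδ, hv, h⟩ := exists_polynomial_kernel_section (critMatrix f) p.1 p.2
    ((critMatrix_mulVec_eq_zero_iff f _ _).2 hs)
  rw [rank_critMatrix f _ hf, hr] at h
  let G : PolyR n := aeval (Sum.elim X v) g
  have hG : ∀ x, eval x G = eval (Sum.elim x fun j => eval x (v j)) g := by
    intro x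
    simp only [G, aeval_def, eval₂_eq_eval_map]
    rw [← eval₂_eq_eval_map, MvPolynomial.hom_eval₂, eval]
    congr 1
    · ext; simp
    · ext (i | j) <;> simp
  refine ⟨δ * (∏ j, f j) * G, ?_, ?_⟩
  · intro h0
    have h1 := congrArg (eval p.1) h0
    rw [map_mul, map_mul, map_prod, map_zero, hG] at h1
    simp only [hv] at h1
    exact mul_ne_zero (mul_ne_zero hδ (Finset.prod_ne_zero_iff.2 fun j _ => hf j)) hg h1
  · intro x hx
    rw [map_mul, map_mul, map_prod, mul_ne_zero_iff, mul_ne_zero_iff, Finset.prod_ne_zero_iff,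
      hG] at hx
    obtain ⟨⟨hx1, hx2⟩, hx3⟩ := hx
    have hfx : ∀ j, eval x (f j) ≠ 0 := fun j => hx2 j (Finset.mem_univ j)
    have hle := rank_jacAt_le_jacMaxRank f x
    have h' := h x hx1
    rw [rank_critMatrix f x hfx] at h'
    exact ⟨_, ⟨hfx, hle.antisymm h'.1, (critMatrix_mulVec_eq_zero_iff f _ _).1 (h'.2 hle)⟩, hx3⟩

/-- Two polynomials that are nonzero at one point each are simultaneously nonzero at some point of
the line through these points. -/
theorem MvPolynomial.exists_line_eval_ne_zero {K τ : Type*} [Field K] [Infinite K]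
    (g h : MvPolynomial τ K) (a b : τ → K) (ha : eval a g ≠ 0) (hb : eval b h ≠ 0) :
    ∃ u : K, eval (fun i => (1 - u) * a i + u * b i) g ≠ 0 ∧
      eval (fun i => (1 - u) * a i + u * b i) h ≠ 0 := by
  let L : τ → Polynomial K := fun i =>
    (1 - Polynomial.X) * Polynomial.C (a i) + Polynomial.X * Polynomial.C (b i)
  have hL : ∀ (q : MvPolynomial τ K) (u : K), (aeval L q).eval u =
      eval (fun i => (1 - u) * a i + u * b i) q := by
    intro q u
    rw [aeval_def, ← Polynomial.coe_evalRingHom, MvPolynomial.hom_eval₂, eval]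
    congr 1
    · ext; simp
    · ext i
      simp only [L, Polynomial.coe_evalRingHom, Polynomial.eval_add,
        Polynomial.eval_mul, Polynomial.eval_sub, Polynomial.eval_one, Polynomial.eval_X,
        Polynomial.eval_C]
  have hg0 : aeval L g ≠ 0 := fun h0 => ha (by simpa [h0] using (hL g 0).symm)
  have hh0 : aeval L h ≠ 0 := fun h0 => hb (by simpa [h0] using (hL h 1).symm)
  by_contra! hcon
  refine mul_ne_zero hg0 hh0 (Polynomial.funext fun u => ?_)
  rw [Polynomial.eval_mul, hL, hL, Polynomial.eval_zero, mul_eq_zero, or_iff_not_imp_left]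
  exact hcon u

/-- For `m > n` nonzero homogeneous polynomials of positive degree, the
likelihood ideal `I(A)` — the ideal of all polynomials in `ℂ[x,s]` vanishing on the
critical-point locus of the log-likelihood — is prime. -/
theorem statement5 {n m : ℕ} (hmn : n < m) (f : Fin m → PolyR n) (d : Fin m → ℕ)
    (hne : ∀ i, f i ≠ 0)
    (hhom : ∀ i, (f i).IsHomogeneous (d i))
    (hd : ∀ i, 0 < d i) :
    (likelihoodIdeal f).IsPrime := by
  refine ⟨?_, ?_⟩
  · rw [Ideal.ne_top_iff_one]
    intro h1
    obtain ⟨p, hp⟩ := critLocus_nonempty f hne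
    simpa using h1 p hp
  · intro g h hgh
    by_contra! hcon
    obtain ⟨hg, hh⟩ := hcon
    obtain ⟨p, hp, hgp⟩ : ∃ p ∈ critLocus f, eval (Sum.elim p.1 p.2) g ≠ 0 := by
      by_contra! hc
      exact hg hc
    obtain ⟨q, hq, hhq⟩ : ∃ p ∈ critLocus f, eval (Sum.elim p.1 p.2) h ≠ 0 := by
      by_contra! hc
      exact hh hc
    obtain ⟨D, hD, hDs⟩ := exists_open_of_eval_ne_zero f g p hp hgp
    obtain ⟨E, hE, hEs⟩ := exists_open_of_eval_ne_zero f h q hq hhq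
    obtain ⟨x, hx⟩ := MvPolynomial.exists_eval_ne_zero (mul_ne_zero hD hE)
    rw [map_mul, mul_ne_zero_iff] at hx
    obtain ⟨s, hs, hgs⟩ := hDs x hx.1
    obtain ⟨t, ht, hht⟩ := hEs x hx.2
    obtain ⟨u, hu1, hu2⟩ := MvPolynomial.exists_line_eval_ne_zero g h _ _ hgs hht
    have hline : (fun i => (1 - u) * Sum.elim x s i + u * Sum.elim x t i) =
        Sum.elim x ((1 - u) • s + u • t) := by
      ext (i | j)
      · simp only [Sum.elim_inl]; ring
      · simp
    rw [hline] at hu1 hu2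
    have hmem : (x, (1 - u) • s + u • t) ∈ critLocus f := by
      refine ⟨hs.1, hs.2.1, (critMatrix_mulVec_eq_zero_iff f _ _).1 ?_⟩
      rw [Matrix.mulVec_add, Matrix.mulVec_smul, Matrix.mulVec_smul,
        (critMatrix_mulVec_eq_zero_iff f _ _).2 hs.2.2,
        (critMatrix_mulVec_eq_zero_iff f _ _).2 ht.2.2]
      simp
    have h0 := hgh _ hmem
    rw [map_mul] at h0
    exact mul_ne_zero hu1 hu2 h0

end
end

section
/- Let f_1,…,f_m ∈ ℂ[x_1,…,x_n] be nonzero, pairwise coprime homogeneous polynomials of positive degree with m > n. Then the arrangement A is gentle, i.e., I_0(A) = I(A), if and only if the pre-likelihood ideal I_0(A) is a prime ideal of ℂ[x_1,…,x_n,s_1,…,s_m]. -/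
open MvPolynomial

noncomputable section

variable {n : ℕ} {ι : Type} [Fintype ι]

theorem Matrix.exists_mul_mul_eq_one {K m n : Type*} [Field K] [Fintype m] [Fintype n]
    [DecidableEq m] [DecidableEq n] (A : Matrix m n K) :
    ∃ (X : Matrix (Fin A.rank) m K) (Y : Matrix n (Fin A.rank) K), X * A * Y = 1 := by
  let b := Module.finBasis K (LinearMap.range A.mulVecLin)
  choose y hy using fun k => (b k).2
  have hli : LinearIndependent K fun k : Fin A.rank => (b k : m → K) :=
    b.linearIndependent.map' (Submodule.subtype _) (Submodule.ker_subtype _)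
  let Y : Matrix n (Fin A.rank) K := Matrix.of fun j k => y k j
  have hcol : ∀ k, (A * Y).col k = (b k : m → K) := fun k => by
    rw [← hy k]
    rfl
  have hinj : Function.Injective (A * Y).mulVec := by
    rw [Matrix.mulVec_injective_iff, show (A * Y).col = _ from _root_.funext hcol]
    exact hli
  obtain ⟨g, hg⟩ := LinearMap.exists_leftInverse_of_injective (A * Y).mulVecLin
    (LinearMap.ker_eq_bot.mpr hinj)
  refine ⟨LinearMap.toMatrix' g, Y, ?_⟩
  rw [Matrix.mul_assoc, ← LinearMap.toMatrix'_toLin' (A * Y), ← LinearMap.toMatrix'_comp,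
    Matrix.toLin'_apply', hg, LinearMap.toMatrix'_id]

theorem Matrix.mul_adjugate_mul_eq_det_smul {K m n r : Type*} [Field K] [Fintype m] [Fintype n]
    [Fintype r] [DecidableEq n] [DecidableEq r] (A : Matrix m n K) (X : Matrix r m K)
    (Y : Matrix n r K) (hA : A.rank ≤ Fintype.card r) (hdet : (X * A * Y).det ≠ 0) :
    A * (Y * (X * A * Y).adjugate * X) * A = (X * A * Y).det • A := by
  have hrange : LinearMap.range (A * Y).mulVecLin = LinearMap.range A.mulVecLin := by
    apply Submodule.eq_of_le_of_finrank_le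
    · rw [Matrix.mulVecLin_mul]
      exact LinearMap.range_comp_le_range _ _
    · calc A.rank ≤ Fintype.card r := hA
        _ = (X * A * Y).rank := (Matrix.rank_of_det_ne_zero hdet).symm
        _ ≤ (A * Y).rank := by rw [Matrix.mul_assoc]; exact Matrix.rank_mul_le_right _ _
  have hZ : ∃ Z : Matrix r n K, A = A * Y * Z := by
    have h : ∀ j, ∃ z, (A * Y).mulVec z = A.col j := fun j => by
      have : A.col j ∈ LinearMap.range (A * Y).mulVecLin := by
        rw [hrange]
        exact ⟨Pi.single j 1, by simp⟩
      exact this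
    choose z hz using h
    refine ⟨Matrix.of fun k j => z j k, ?_⟩
    ext i j
    exact (congrFun (hz j) i).symm
  obtain ⟨Z, hZ⟩ := hZ
  calc A * (Y * (X * A * Y).adjugate * X) * A
      = A * (Y * (X * A * Y).adjugate * X) * (A * Y * Z) := by rw [← hZ]
    _ = A * Y * ((X * A * Y).adjugate * (X * A * Y)) * Z := by simp only [Matrix.mul_assoc]
    _ = (X * A * Y).det • (A * Y * Z) := by
      rw [Matrix.adjugate_mul]; simp
    _ = _ := by rw [← hZ]

/-- The Jacobian matrix of the polynomial map `f`. -/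
def jacPoly {κ : Type} (f : κ → PolyR n) : Matrix κ (Fin n) (PolyR n) :=
  Matrix.of fun i j => pderiv j (f i)

theorem jacPoly_map_eval {κ : Type} (f : κ → PolyR n) (x : Fin n → ℂ) :
    (jacPoly f).map (eval x) = jacAt f x := rfl

/-- `C / q` is a generalized inverse of the Jacobian matrix, and `q` vanishes wherever the
Jacobian matrix fails to have maximal rank. -/
structure IsJacInverse (f : ι → PolyR n) (q : PolyR n) (C : Matrix (Fin n) ι (PolyR n)) :
    Prop where
  mul_mul : jacPoly f * C * jacPoly f = q • jacPoly f
  rank_eq : ∀ x, eval x q ≠ 0 → (jacAt f x).rank = jacMaxRank f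

theorem exists_isJacInverse [DecidableEq ι] (f : ι → PolyR n) {x : Fin n → ℂ}
    (hx : (jacAt f x).rank = jacMaxRank f) :
    ∃ q C, IsJacInverse f q C ∧ eval x q ≠ 0 := by
  obtain ⟨X₀, Y₀, hXY⟩ := (jacAt f x).exists_mul_mul_eq_one
  let X := X₀.map (MvPolynomial.C : ℂ → PolyR n)
  let Y := Y₀.map (MvPolynomial.C : ℂ → PolyR n)
  have hX : ∀ y, X.map (eval y) = X₀ := fun y => by ext; simp [X]
  have hY : ∀ y, Y.map (eval y) = Y₀ := fun y => by ext; simp [Y]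
  have hB : ∀ y, (X * jacPoly f * Y).map (eval y) = X₀ * jacAt f y * Y₀ := fun y => by
    rw [Matrix.map_mul, Matrix.map_mul, hX, hY, jacPoly_map_eval]
  have hq : ∀ y, eval y (X * jacPoly f * Y).det = (X₀ * jacAt f y * Y₀).det := fun y => by
    rw [← hB, RingHom.map_det]; rfl
  have hadj : ∀ y, (X * jacPoly f * Y).adjugate.map (eval y) =
      (X₀ * jacAt f y * Y₀).adjugate := fun y => by
    rw [← hB]; exact RingHom.map_adjugate (eval y) _
  have hqx : eval x (X * jacPoly f * Y).det ≠ 0 := by rw [hq, hXY]; simp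
  have hrank : ∀ y, eval y (X * jacPoly f * Y).det ≠ 0 →
      (jacAt f y).rank = jacMaxRank f := fun y hy => by
    refine le_antisymm (rank_jacAt_le_jacMaxRank f y) ?_
    rw [hq] at hy
    have h := Matrix.rank_of_det_ne_zero hy
    rw [Fintype.card_fin] at h
    rw [← hx, ← h]
    exact (Matrix.rank_mul_le_left _ _).trans (Matrix.rank_mul_le_right _ _)
  refine ⟨(X * jacPoly f * Y).det, Y * (X * jacPoly f * Y).adjugate * X, ⟨?_, hrank⟩, hqx⟩
  have hne : (X * jacPoly f * Y).det ≠ 0 := fun h => hqx (by rw [h, map_zero])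
  ext1 i j
  refine mul_left_cancel₀ hne (MvPolynomial.funext fun y => ?_)
  rw [map_mul, map_mul]
  by_cases hy : eval y (X * jacPoly f * Y).det = 0
  · simp [hy]
  congr 1
  have key := Matrix.mul_adjugate_mul_eq_det_smul (jacAt f y) X₀ Y₀
    (by rw [Fintype.card_fin, hrank y hy, hx]) (by rwa [← hq])
  have key' : (jacPoly f * (Y * (X * jacPoly f * Y).adjugate * X) * jacPoly f).map (eval y) =
      ((X * jacPoly f * Y).det • jacPoly f).map (eval y) := by
    simp only [Matrix.map_mul, hX, hY, hadj, jacPoly_map_eval]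
    rw [key, ← hq]
    ext i j
    simp [jacPoly, jacAt]
  exact congrFun (congrFun key' i) j

/-- The matrix `q - J C`, whose rows span the left kernel of the Jacobian matrix `J`
where `q` does not vanish. -/
def leftKerMatrix [DecidableEq ι] (f : ι → PolyR n) (q : PolyR n)
    (C : Matrix (Fin n) ι (PolyR n)) : Matrix ι ι (PolyR n) :=
  q • (1 : Matrix ι ι (PolyR n)) - jacPoly f * C

theorem leftKerMatrix_mul_jacPoly [DecidableEq ι] {f : ι → PolyR n} {q : PolyR n}
    {C : Matrix (Fin n) ι (PolyR n)} (h : IsJacInverse f q C) :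
    leftKerMatrix f q C * jacPoly f = 0 := by
  rw [leftKerMatrix, Matrix.sub_mul, h.mul_mul, Matrix.smul_mul, Matrix.one_mul, sub_self]

/-- The parametrization `s_i = f_i Σ_j t_j E_{ji}` of the critical locus, as a ring map. -/
def paramHom (f : ι → PolyR n) (E : Matrix ι ι (PolyR n)) : PolyRS n ι →ₐ[ℂ] PolyRS n ι :=
  aeval (Sum.elim (fun j => X (Sum.inl j))
    (fun i => rename Sum.inl (f i) * ∑ j, X (Sum.inr j) * rename Sum.inl (E j i)))

theorem eval_sumElim_rename_inl {κ : Type} (x : Fin n → ℂ) (s : κ → ℂ) (p : PolyR n) :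
    eval (Sum.elim x s) (rename Sum.inl p) = eval x p := by
  rw [eval_rename, Sum.elim_comp_inl]

theorem eval_paramHom (f : ι → PolyR n) (E : Matrix ι ι (PolyR n)) (x : Fin n → ℂ) (t : ι → ℂ)
    (p : PolyRS n ι) :
    eval (Sum.elim x t) (paramHom f E p) =
      eval (Sum.elim x fun i => eval x (f i) * Matrix.vecMul t (E.map (eval x)) i) p := by
  have : (eval (Sum.elim x t)).comp (paramHom f E : PolyRS n ι →+* PolyRS n ι) =
      eval (Sum.elim x fun i => eval x (f i) * Matrix.vecMul t (E.map (eval x)) i) := by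
    apply MvPolynomial.ringHom_ext
    · intro r; simp [paramHom]
    · rintro (j | i)
      · simp [paramHom]
      · simp [paramHom, eval_sumElim_rename_inl, Matrix.vecMul, dotProduct]
  exact RingHom.congr_fun this p

theorem mem_critLocus_iff [DecidableEq ι] {f : ι → PolyR n} {x : Fin n → ℂ} {v : ι → ℂ}
    (hf : ∀ j, eval x (f j) ≠ 0) (hr : (jacAt f x).rank = jacMaxRank f) :
    (x, fun i => eval x (f i) * v i) ∈ critLocus f ↔ Matrix.vecMul v (jacAt f x) = 0 := by
  have hF : ∏ k, eval x (f k) ≠ 0 := Finset.prod_ne_zero_iff.mpr fun k _ => hf k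
  have key : ∀ i : Fin n, ∑ j, (eval x (f j) * v j) * eval x (pderiv i (f j)) *
      ∏ k ∈ Finset.univ.erase j, eval x (f k) =
      (∏ k, eval x (f k)) * Matrix.vecMul v (jacAt f x) i := fun i => by
    simp only [Matrix.vecMul, dotProduct, Finset.mul_sum, jacAt, Matrix.of_apply]
    refine Finset.sum_congr rfl fun j _ => ?_
    rw [← Finset.mul_prod_erase Finset.univ _ (Finset.mem_univ j)]
    ring
  simp only [critLocus, Set.mem_ofPred_eq, key, mul_eq_zero, hF, false_or, funext_iff,
    Pi.zero_apply]
  exact ⟨fun h => h.2.2, fun h => ⟨hf, hr, h⟩⟩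

theorem paramPoint_mem_critLocus [DecidableEq ι] {f : ι → PolyR n} {q : PolyR n}
    {C : Matrix (Fin n) ι (PolyR n)} (h : IsJacInverse f q C) {x : Fin n → ℂ}
    (hf : ∀ j, eval x (f j) ≠ 0) (hq : eval x q ≠ 0) (t : ι → ℂ) :
    (x, fun i => eval x (f i) *
      Matrix.vecMul t ((leftKerMatrix f q C).map (eval x)) i) ∈ critLocus f := by
  rw [mem_critLocus_iff hf (h.rank_eq x hq), Matrix.vecMul_vecMul, ← jacPoly_map_eval,
    ← Matrix.map_mul, leftKerMatrix_mul_jacPoly h]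
  simp

theorem exists_paramPoint_eq [DecidableEq ι] {f : ι → PolyR n} {q : PolyR n}
    (C : Matrix (Fin n) ι (PolyR n)) {x : Fin n → ℂ} {s : ι → ℂ}
    (hs : (x, s) ∈ critLocus f) (hq : eval x q ≠ 0) :
    ∃ t, s = fun i => eval x (f i) *
      Matrix.vecMul t ((leftKerMatrix f q C).map (eval x)) i := by
  have hf : ∀ j, eval x (f j) ≠ 0 := hs.1
  have hsv : s = fun i => eval x (f i) * (s i / eval x (f i)) :=
    funext fun i => (mul_div_cancel₀ _ (hf i)).symm
  rw [hsv, mem_critLocus_iff hf hs.2.1] at hs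
  refine ⟨(eval x q)⁻¹ • fun i => s i / eval x (f i), ?_⟩
  have hE : (leftKerMatrix f q C).map (eval x) =
      eval x q • (1 : Matrix ι ι ℂ) - jacAt f x * C.map (eval x) := by
    rw [← jacPoly_map_eval, ← Matrix.map_mul]
    ext i j
    simp only [leftKerMatrix, Matrix.map_apply, Matrix.sub_apply, Matrix.smul_apply,
      Matrix.one_apply, map_sub, smul_eq_mul, map_mul, apply_ite (eval x), map_one, map_zero]
  rw [hE, Matrix.smul_vecMul, Matrix.vecMul_sub, ← Matrix.vecMul_vecMul, hs,
    Matrix.zero_vecMul, sub_zero, Matrix.vecMul_smul, Matrix.vecMul_one, smul_smul,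
    inv_mul_cancel₀ hq, one_smul]
  exact hsv

theorem prod_mul_ne_zero {f : ι → PolyR n} (hne : ∀ i, f i ≠ 0) {q : PolyR n} (hq : q ≠ 0) :
    q * ∏ i, f i ≠ 0 :=
  mul_ne_zero hq (Finset.prod_ne_zero_iff.mpr fun i _ => hne i)

theorem eval_mul_prod_ne_zero_iff {f : ι → PolyR n} {q : PolyR n} {x : Fin n → ℂ} :
    eval x (q * ∏ i, f i) ≠ 0 ↔ eval x q ≠ 0 ∧ ∀ j, eval x (f j) ≠ 0 := by
  simp [map_prod, Finset.prod_eq_zero_iff]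

theorem paramHom_eq_zero_of_forall [DecidableEq ι] {f : ι → PolyR n} {E : Matrix ι ι (PolyR n)}
    {h : PolyR n} (hh : h ≠ 0) {p : PolyRS n ι}
    (hp : ∀ x t, eval x h ≠ 0 →
      eval (Sum.elim x fun i => eval x (f i) * Matrix.vecMul t (E.map (eval x)) i) p = 0) :
    paramHom f E p = 0 := by
  have hh' : rename (Sum.inl : Fin n → Fin n ⊕ ι) h ≠ 0 :=
    (map_ne_zero_iff _ (rename_injective _ Sum.inl_injective)).mpr hh
  refine mul_left_cancel₀ hh' (MvPolynomial.funext fun y => ?_)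
  rw [← Sum.elim_comp_inl_inr y, map_mul, eval_sumElim_rename_inl, eval_paramHom, mul_zero,
    map_zero]
  by_cases hx : eval (y ∘ Sum.inl) h = 0
  · rw [hx, zero_mul]
  · rw [hp _ _ hx, mul_zero]

theorem paramHom_eq_zero_of_mem [DecidableEq ι] {f : ι → PolyR n} (hne : ∀ i, f i ≠ 0)
    {q : PolyR n} {C : Matrix (Fin n) ι (PolyR n)} (h : IsJacInverse f q C) (hq : q ≠ 0)
    {p : PolyRS n ι} (hp : p ∈ likelihoodIdeal f) :
    paramHom f (leftKerMatrix f q C) p = 0 := by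
  refine paramHom_eq_zero_of_forall (prod_mul_ne_zero hne hq) fun x t hx => ?_
  obtain ⟨hqx, hfx⟩ := eval_mul_prod_ne_zero_iff.mp hx
  exact hp (x, _) (paramPoint_mem_critLocus h hfx hqx t)

theorem mem_likelihoodIdeal_of_paramHom_eq_zero [DecidableEq ι] {f : ι → PolyR n}
    (hne : ∀ i, f i ≠ 0) {q : PolyR n} {C : Matrix (Fin n) ι (PolyR n)} (hq : q ≠ 0)
    {p : PolyRS n ι} (hp : paramHom f (leftKerMatrix f q C) p = 0) :
    p ∈ likelihoodIdeal f := by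
  rintro ⟨x, s⟩ hs
  obtain ⟨q', C', h', hq'⟩ := exists_isJacInverse f hs.2.1
  have hp' : paramHom f (leftKerMatrix f q' C') p = 0 := by
    have hq'0 : q' ≠ 0 := fun h0 => hq' (by rw [h0, map_zero])
    refine paramHom_eq_zero_of_forall
      (mul_ne_zero hq (prod_mul_ne_zero hne hq'0)) fun y t hy => ?_
    rw [map_mul, mul_ne_zero_iff, eval_mul_prod_ne_zero_iff] at hy
    obtain ⟨t', ht'⟩ := exists_paramPoint_eq C
      (paramPoint_mem_critLocus h' hy.2.2 hy.2.1 t) hy.1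
    rw [ht', ← eval_paramHom, hp, map_zero]
  obtain ⟨t, ht⟩ := exists_paramPoint_eq C' hs hq'
  change eval (Sum.elim x s) p = 0
  rw [ht, ← eval_paramHom, hp', map_zero]

theorem likelihoodIdeal_eq_ker [DecidableEq ι] {f : ι → PolyR n} (hne : ∀ i, f i ≠ 0)
    {q : PolyR n} {C : Matrix (Fin n) ι (PolyR n)} (h : IsJacInverse f q C) (hq : q ≠ 0) :
    likelihoodIdeal f = RingHom.ker (paramHom f (leftKerMatrix f q C)) :=
  Ideal.ext fun _ => ⟨paramHom_eq_zero_of_mem hne h hq,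
    mem_likelihoodIdeal_of_paramHom_eq_zero hne hq⟩

theorem preLikelihoodIdeal_le_likelihoodIdeal [DecidableEq ι] (f : ι → PolyR n) :
    preLikelihoodIdeal f ≤ likelihoodIdeal f := by
  refine Ideal.span_le.mpr ?_
  rintro _ ⟨a, ⟨b, hb⟩, rfl⟩ ⟨x, s⟩ hs
  have hf : ∀ j, eval x (f j) ≠ 0 := hs.1
  have hsv : s = fun i => eval x (f i) * (s i / eval x (f i)) :=
    funext fun i => (mul_div_cancel₀ _ (hf i)).symm
  have hr := hs.2.1
  rw [hsv, mem_critLocus_iff hf hr] at hs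
  have hb' : ∀ i, eval x (a i) * s i =
      -((s i / eval x (f i)) * (jacAt f x).mulVec (fun j => eval x (b j)) i) := fun i => by
    have h := congrArg (eval x) (hb i)
    simp only [map_add, map_mul, map_sum, map_zero] at h
    have h2 : (jacAt f x).mulVec (fun j => eval x (b j)) i =
        ∑ j, eval x (b j) * eval x (pderiv j (f i)) := by
      simp [Matrix.mulVec, dotProduct, jacAt, mul_comm]
    rw [h2]
    field_simp [hf i]
    linear_combination s i * h
  change eval (Sum.elim x s) _ = 0
  simp only [map_sum, map_mul, eval_sumElim_rename_inl, eval_X, Sum.elim_inr, hb',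
    Finset.sum_neg_distrib]
  have h := Matrix.dotProduct_mulVec (fun i => s i / eval x (f i)) (jacAt f x)
    (fun j => eval x (b j))
  rw [hs, zero_dotProduct] at h
  exact neg_eq_zero.mpr h

theorem sum_pderiv_mul_prod_erase_mem [DecidableEq ι] (f : ι → PolyR n) (j : Fin n) :
    ∑ i, rename Sum.inl (pderiv j (f i) * ∏ k ∈ Finset.univ.erase i, f k) * X (Sum.inr i) ∈
      preLikelihoodIdeal f := by
  refine Ideal.subset_span ⟨fun i => pderiv j (f i) * ∏ k ∈ Finset.univ.erase i, f k,
    ⟨Pi.single j (-∏ k, f k), fun i => ?_⟩, rfl⟩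
  rw [Finset.sum_eq_single j (fun k _ hk => by simp [hk]) (by simp), Pi.single_eq_same,
    ← Finset.mul_prod_erase Finset.univ f (Finset.mem_univ i)]
  ring

theorem mul_X_sub_mem [DecidableEq ι] (f : ι → PolyR n) (q : PolyR n)
    (C : Matrix (Fin n) ι (PolyR n)) (i : ι) :
    rename Sum.inl (q * ∏ k, f k) * X (Sum.inr i) - rename Sum.inl (f i) *
      ∑ j, (rename Sum.inl (∏ k ∈ Finset.univ.erase j, f k) * X (Sum.inr j)) *
        rename Sum.inl (leftKerMatrix f q C j i) ∈ preLikelihoodIdeal f := by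
  have key : rename Sum.inl (q * ∏ k, f k) * X (Sum.inr i) - rename Sum.inl (f i) *
      ∑ j, (rename Sum.inl (∏ k ∈ Finset.univ.erase j, f k) * X (Sum.inr j)) *
        rename Sum.inl (leftKerMatrix f q C j i) =
      ∑ l, (rename Sum.inl (f i * C l i) : PolyRS n ι) *
        ∑ j, rename Sum.inl (pderiv l (f j) * ∏ k ∈ Finset.univ.erase j, f k) *
          X (Sum.inr j) := by
    have hE : ∀ j, leftKerMatrix f q C j i =
        (if j = i then q else 0) - ∑ l, pderiv l (f j) * C l i := fun j => by
      simp [leftKerMatrix, jacPoly, Matrix.mul_apply, Matrix.one_apply]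
    simp only [hE, map_sub, mul_sub, Finset.sum_sub_distrib, apply_ite, map_zero,
      mul_zero, Finset.sum_ite_eq', Finset.mem_univ, if_true, map_sum, map_mul, Finset.mul_sum]
    rw [Finset.sum_comm (s := Finset.univ (α := Fin n)),
      ← Finset.mul_prod_erase Finset.univ f (Finset.mem_univ i), map_mul,
      sub_sub_eq_add_sub, add_sub_right_comm]
    refine (congrArg₂ (· + ·) (by ring) ?_).trans (zero_add _)
    exact Finset.sum_congr rfl fun _ _ => Finset.sum_congr rfl fun _ _ => by ring
  rw [key]
  exact Ideal.sum_mem _ fun l _ => Ideal.mul_mem_left _ _ (sum_pderiv_mul_prod_erase_mem f l)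

theorem rename_inl_notMem_preLikelihoodIdeal (f : ι → PolyR n) {h : PolyR n} (hh : h ≠ 0) :
    rename Sum.inl h ∉ preLikelihoodIdeal f := by
  let φ : PolyRS n ι →ₐ[ℂ] PolyR n := aeval (Sum.elim X 0)
  have hφ : preLikelihoodIdeal f ≤ RingHom.ker φ := by
    refine Ideal.span_le.mpr ?_
    rintro _ ⟨a, -, rfl⟩
    simp [φ]
  intro hmem
  refine hh ?_
  have := hφ hmem
  rwa [RingHom.mem_ker, show φ = aeval (Sum.elim X 0) from rfl, aeval_rename,
    Sum.elim_comp_inl, aeval_X_left_apply] at this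

theorem likelihoodIdeal_le_preLikelihoodIdeal [DecidableEq ι] {f : ι → PolyR n}
    (hne : ∀ i, f i ≠ 0) (hprime : (preLikelihoodIdeal f).IsPrime) :
    likelihoodIdeal f ≤ preLikelihoodIdeal f := by
  obtain ⟨x, hx⟩ := exists_rank_jacAt_eq_jacMaxRank f
  obtain ⟨q, C, hC, hqx⟩ := exists_isJacInverse f hx
  have hq : q ≠ 0 := fun h0 => hqx (by rw [h0, map_zero])
  intro p hp
  let L := FractionRing (PolyRS n ι ⧸ preLikelihoodIdeal f)
  let π : PolyRS n ι →ₐ[ℂ] L :=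
    (IsScalarTower.toAlgHom ℂ (PolyRS n ι ⧸ preLikelihoodIdeal f) L).comp
      (Ideal.Quotient.mkₐ ℂ (preLikelihoodIdeal f))
  have hπ : ∀ g, π g = 0 ↔ g ∈ preLikelihoodIdeal f := fun g => by
    change algebraMap (PolyRS n ι ⧸ preLikelihoodIdeal f) L
      (Ideal.Quotient.mk (preLikelihoodIdeal f) g) = 0 ↔ _
    rw [FaithfulSMul.algebraMap_eq_zero_iff, Ideal.Quotient.eq_zero_iff_mem]
  let h := q * ∏ k, f k
  have hh : π (rename Sum.inl h) ≠ 0 := fun h0 =>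
    rename_inl_notMem_preLikelihoodIdeal f (prod_mul_ne_zero hne hq) ((hπ _).mp h0)
  let ψ : PolyRS n ι →ₐ[ℂ] L := aeval (Sum.elim (fun j => π (X (Sum.inl j)))
    fun j => π (rename Sum.inl (∏ k ∈ Finset.univ.erase j, f k) * X (Sum.inr j)) /
      π (rename Sum.inl h))
  have hψ : ∀ g : PolyR n, ψ (rename Sum.inl g) = π (rename Sum.inl g) := fun g => by
    have : ψ.comp (rename Sum.inl) = π.comp (rename Sum.inl) := by
      apply MvPolynomial.algHom_ext
      intro j
      simp [ψ]
    exact DFunLike.congr_fun this g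
  have hcomp : ψ.comp (paramHom f (leftKerMatrix f q C)) = π := by
    apply MvPolynomial.algHom_ext
    rintro (j | i)
    · simp [paramHom, ψ]
    · have hi := (hπ _).mpr (mul_X_sub_mem f q C i)
      rw [map_sub, sub_eq_zero, map_mul π, map_mul π, map_sum π] at hi
      have hX : ∀ j, ψ (X (Sum.inr j)) =
        π (rename Sum.inl (∏ k ∈ Finset.univ.erase j, f k) * X (Sum.inr j)) /
          π (rename Sum.inl h) := fun j => by simp only [ψ, aeval_X, Sum.elim_inr]
      rw [← mul_right_inj' hh, hi]
      simp only [AlgHom.comp_apply, paramHom, aeval_X, Sum.elim_inr, map_mul ψ, map_sum ψ, hψ,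
        hX, map_mul π _ (rename Sum.inl (leftKerMatrix f q C _ i))]
      rw [mul_left_comm, Finset.mul_sum]
      congr 1
      refine Finset.sum_congr rfl fun j _ => ?_
      rw [← mul_assoc, mul_div_cancel₀ _ hh]
  rw [← hπ, ← hcomp, AlgHom.comp_apply, paramHom_eq_zero_of_mem hne hC hq hp, map_zero]

/-- The arrangement `A` is gentle (`I₀(A) = I(A)`) if and only if the
pre-likelihood ideal `I₀(A)` is a prime ideal of `ℂ[x,s]`. -/
theorem statement8 {n m : ℕ} (hmn : n < m) (f : Fin m → PolyR n) (d : Fin m → ℕ)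
    (hne : ∀ i, f i ≠ 0)
    (hhom : ∀ i, (f i).IsHomogeneous (d i))
    (hd : ∀ i, 0 < d i)
    (hcop : ∀ i j, i ≠ j → IsRelPrime (f i) (f j)) :
    IsGentle f ↔ (preLikelihoodIdeal f).IsPrime := by
  refine ⟨fun h => ?_, fun h => le_antisymm (preLikelihoodIdeal_le_likelihoodIdeal f)
    (likelihoodIdeal_le_preLikelihoodIdeal hne h)⟩
  obtain ⟨x, hx⟩ := exists_rank_jacAt_eq_jacMaxRank f
  obtain ⟨q, C, hC, hqx⟩ := exists_isJacInverse f hx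
  have hq : q ≠ 0 := fun h0 => hqx (by rw [h0, map_zero])
  rw [show preLikelihoodIdeal f = likelihoodIdeal f from h, likelihoodIdeal_eq_ker hne hC hq]
  exact RingHom.ker_isPrime _

end
end
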